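/- arXiv:1009.4996 — 2 statements merged into one kernel-verified Lean document; each statement's English description precedes it below -/
import Mathlib

section
/- There exist constants C, c > 0, depending only on α, such that for all s > 0 and t > 0, |ψ_{t,α}(s)| ≤ C t^{−1} exp( −c (s t^{−α})^{1/(1−α)} ). -/
open Real

/-- `ψ_{t,α}(s) = t⁻¹ ∑_{k=1}^∞ (-s t^{-α})^k / (k! Γ(-α k))`,
the Wright function `t⁻¹ ₀Ψ₁[ -; (0,-α) | -s t^{-α} ]`. -/
noncomputable def psiSub (α t s : ℝ) : ℝ :=
  t⁻¹ * ∑' k : ℕ, (-(s * t ^ (-α))) ^ (k + 1) /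
    ((k + 1).factorial * Real.Gamma (-(α * (k + 1))))

open Set MeasureTheory Filter Topology

/-- The integrand `exp (z - x z ^ α) dz / du` along the ray `z = u exp (i θ)`. -/
noncomputable def wrightRay (α x θ u : ℝ) : ℂ :=
  Complex.exp (θ * Complex.I) * Complex.exp (u * Complex.exp (θ * Complex.I) -
    x * (u ^ α : ℝ) * Complex.exp ((α * θ : ℝ) * Complex.I))

/-- The form `exp (z - x z ^ α) dz` in the logarithmic coordinate `z = exp ζ`. -/
noncomputable def wrightLog (α x : ℝ) (ζ : ℂ) : ℂ :=
  Complex.exp (ζ + Complex.exp ζ - x * Complex.exp (α * ζ))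

lemma differentiable_wrightLog (α x : ℝ) : Differentiable ℂ (wrightLog α x) := by
  unfold wrightLog
  fun_prop

lemma continuous_wrightRay {α : ℝ} (hα : 0 ≤ α) (x θ : ℝ) : Continuous (wrightRay α x θ) := by
  unfold wrightRay
  have h : Continuous fun u : ℝ ↦ u ^ α := Real.continuous_rpow_const hα
  fun_prop

lemma norm_wrightRay (α x θ u : ℝ) :
    ‖wrightRay α x θ u‖ = exp (u * cos θ - x * u ^ α * cos (α * θ)) := by
  rw [wrightRay, norm_mul, Complex.norm_exp_ofReal_mul_I, one_mul, Complex.norm_exp,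
    Complex.sub_re, ← Complex.ofReal_mul, Complex.re_ofReal_mul, Complex.re_ofReal_mul,
    Complex.exp_ofReal_mul_I_re, Complex.exp_ofReal_mul_I_re]

lemma norm_wrightLog (α x v y : ℝ) :
    ‖wrightLog α x (v + y * Complex.I)‖ =
      exp (v + exp v * cos y - x * (exp (α * v) * cos (α * y))) := by
  rw [wrightLog, Complex.norm_exp]
  congr 1
  simp [Complex.exp_re]

lemma wrightLog_eq_smul_wrightRay (α x θ v : ℝ) :
    wrightLog α x (v + θ * Complex.I) = exp v • wrightRay α x θ (exp v) := by
  rw [wrightRay, wrightLog, Complex.real_smul, ← Real.exp_mul, Complex.ofReal_exp,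
    Complex.ofReal_exp, ← Complex.exp_add, ← Complex.exp_add, mul_assoc (x : ℂ),
    ← Complex.exp_add, ← Complex.exp_add]
  congr 1
  push_cast
  rw [show (α : ℂ) * (v + θ * Complex.I) = v * α + α * θ * Complex.I by ring]
  ring

lemma wrightLog_ofReal_im (α x v : ℝ) : (wrightLog α x v).im = 0 := by
  have h : wrightLog α x v = ((exp (v + exp v - x * exp (α * v)) : ℝ) : ℂ) := by
    simp [wrightLog]
  rw [h, Complex.ofReal_im]

lemma norm_wrightLog_le {α x v y θ : ℝ} (hα : α ∈ Ioo (0 : ℝ) 1) (hx : 0 ≤ x)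
    (hαθ : α * θ ≤ π / 2) (hy : y ∈ Icc 0 θ) :
    ‖wrightLog α x (v + y * Complex.I)‖ ≤
      exp v * exp (exp v - x * exp (α * v) * cos (α * θ)) := by
  rw [norm_wrightLog, ← exp_add, exp_le_exp]
  have h1 : exp v * cos y ≤ exp v := mul_le_of_le_one_right (exp_pos v).le (cos_le_one y)
  have h2 : cos (α * θ) ≤ cos (α * y) :=
    cos_le_cos_of_nonneg_of_le_pi (mul_nonneg hα.1.le hy.1) (by linarith [pi_pos])
      (mul_le_mul_of_nonneg_left hy.2 hα.1.le)
  have h3 := mul_le_mul_of_nonneg_left h2 (mul_nonneg hx (exp_pos (α * v)).le)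
  linarith

/-- Cauchy's theorem for the circular sector of radii `ε < r` and angle `θ`: up to real numbers,
the ray integral reduces to integrals over the two arcs. -/
lemma abs_im_integral_wrightRay_le {α x θ ε r : ℝ} (hα : α ∈ Ioo (0 : ℝ) 1) (hx : 0 ≤ x)
    (hθ : 0 ≤ θ) (hαθ : α * θ ≤ π / 2) (hε : 0 < ε) (hr : 0 < r) :
    |(∫ u in ε..r, wrightRay α x θ u).im| ≤
      θ * (r * exp (r - x * r ^ α * cos (α * θ))) + θ * (ε * exp ε) := by
  have hsub : ∫ u in ε..r, wrightRay α x θ u =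
      ∫ v in log ε..log r, wrightLog α x (v + θ * Complex.I) := by
    have := intervalIntegral.integral_deriv_smul_comp (a := log ε) (b := log r) (f := exp)
      (f' := exp) (g := wrightRay α x θ) (fun v _ ↦ Real.hasDerivAt_exp v)
      Real.continuous_exp.continuousOn (continuous_wrightRay hα.1.le x θ)
    rw [exp_log hε, exp_log hr] at this
    rw [← this]
    exact intervalIntegral.integral_congr fun v _ ↦ (wrightLog_eq_smul_wrightRay α x θ v).symm
  have hreal : (∫ v in log ε..log r, wrightLog α x v).im = 0 := by
    have h : ∫ v in log ε..log r, wrightLog α x v =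
        ∫ v in log ε..log r, (((wrightLog α x v).re : ℝ) : ℂ) :=
      intervalIntegral.integral_congr fun v _ ↦
        Complex.ext (by simp) (by simpa using wrightLog_ofReal_im α x v)
    rw [h, intervalIntegral.integral_ofReal, Complex.ofReal_im]
  have hcauchy := Complex.integral_boundary_rect_eq_zero_of_differentiableOn (wrightLog α x)
    (log ε) (log r + θ * Complex.I) (differentiable_wrightLog α x).differentiableOn
  simp only [Complex.add_re, Complex.add_im, Complex.ofReal_re, Complex.ofReal_im,
    Complex.re_ofReal_mul, Complex.im_ofReal_mul, Complex.I_re, Complex.I_im, mul_zero, mul_one,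
    add_zero, zero_add, zero_mul, Complex.ofReal_zero, smul_eq_mul] at hcauchy
  have harc (R : ℝ) (hR : 0 < R) :
      ‖∫ y in (0 : ℝ)..θ, wrightLog α x (log R + y * Complex.I)‖ ≤
        θ * (R * exp (R - x * R ^ α * cos (α * θ))) := by
    have := intervalIntegral.norm_integral_le_of_norm_le_const (a := 0) (b := θ)
      (f := fun y : ℝ ↦ wrightLog α x (log R + y * Complex.I))
      (C := R * exp (R - x * R ^ α * cos (α * θ))) fun y hy ↦ by
        rw [uIoc_of_le hθ] at hy
        have := norm_wrightLog_le (v := log R) hα hx hαθ ⟨hy.1.le, hy.2⟩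
        rwa [exp_log hR, mul_comm α, ← rpow_def_of_pos hR] at this
    rwa [sub_zero, abs_of_nonneg hθ, mul_comm] at this
  have hcos : 0 ≤ cos (α * θ) :=
    cos_nonneg_of_neg_pi_div_two_le_of_le (by nlinarith [pi_pos, hα.1]) hαθ
  have hεbound : θ * (ε * exp (ε - x * ε ^ α * cos (α * θ))) ≤ θ * (ε * exp ε) := by
    gcongr
    have : 0 ≤ x * ε ^ α * cos (α * θ) := by positivity
    linarith
  have him : (∫ u in ε..r, wrightRay α x θ u).im =
      (Complex.I * ∫ y in (0 : ℝ)..θ, wrightLog α x (log r + y * Complex.I)).im -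
        (Complex.I * ∫ y in (0 : ℝ)..θ, wrightLog α x (log ε + y * Complex.I)).im := by
    rw [hsub]
    have := congrArg Complex.im hcauchy
    simp only [Complex.add_im, Complex.sub_im, Complex.zero_im, hreal] at this
    linarith
  rw [him]
  refine (abs_sub _ _).trans (add_le_add ?_ ?_)
  · refine (Complex.abs_im_le_norm _).trans ?_
    rw [norm_mul, Complex.norm_I, one_mul]
    exact harc r hr
  · refine (Complex.abs_im_le_norm _).trans ?_
    rw [norm_mul, Complex.norm_I, one_mul]
    exact (harc ε hε).trans hεbound

lemma integrableOn_exp_rpow_sub_mul {α b : ℝ} (hα : α ∈ Ioo (0 : ℝ) 1) (x : ℝ) (hb : 0 < b) :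
    IntegrableOn (fun u : ℝ ↦ exp (x * u ^ α - b * u)) (Ioi 0) := by
  refine integrable_of_isBigO_exp_neg (half_pos hb) ?_ ?_
  · have h : Continuous fun u : ℝ ↦ u ^ α := Real.continuous_rpow_const hα.1.le
    fun_prop
  · have h1 : (fun u : ℝ ↦ x * u ^ α) =o[atTop] fun u : ℝ ↦ u := by
      refine (Asymptotics.isLittleO_of_tendsto' ?_ ?_).const_mul_left x
      · filter_upwards [eventually_gt_atTop 0] with u hu h0
        exact absurd h0 hu.ne'
      · refine (tendsto_rpow_neg_atTop (sub_pos.mpr hα.2)).congr' ?_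
        filter_upwards [eventually_gt_atTop 0] with u hu
        rw [neg_sub, rpow_sub_one hu.ne']
    refine Asymptotics.IsBigO.of_bound 1 ?_
    filter_upwards [h1.bound (half_pos hb), eventually_ge_atTop 0] with u hu hu0
    rw [norm_of_nonneg (exp_pos _).le, norm_of_nonneg (exp_pos _).le, one_mul, exp_le_exp]
    rw [Real.norm_of_nonneg hu0] at hu
    linarith [le_abs_self (x * u ^ α), Real.norm_eq_abs (x * u ^ α)]

/-- The Laplace transform of a power, at a complex point. -/
lemma integral_rpow_mul_cexp {a : ℝ} (ha : 0 < a) {z : ℂ} (hz : z.re < 0) :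
    ∫ u in Ioi (0 : ℝ), ((u ^ (a - 1) : ℝ) : ℂ) * Complex.exp (z * u) =
      (-z)⁻¹ ^ (a : ℂ) * Real.Gamma a := by
  let μ : Measure ℝ := (volume.restrict (Ioi 0)).withDensity fun u ↦ ↑(u ^ (a - 1)).toNNReal
  have hmeas : Measurable fun u : ℝ ↦ (u ^ (a - 1)).toNNReal := by fun_prop
  have hmgf (w : ℂ) : ProbabilityTheory.complexMGF id μ w =
      ∫ u in Ioi (0 : ℝ), ((u ^ (a - 1) : ℝ) : ℂ) * Complex.exp (w * u) := by
    rw [ProbabilityTheory.complexMGF, integral_withDensity_eq_integral_smul hmeas]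
    refine setIntegral_congr_fun measurableSet_Ioi fun u hu ↦ ?_
    simp [NNReal.smul_def, Real.coe_toNNReal _ (rpow_nonneg (le_of_lt hu) (a - 1))]
  have hset : Iio 0 ⊆ ProbabilityTheory.integrableExpSet id μ := by
    intro b hb
    rw [ProbabilityTheory.integrableExpSet, mem_ofPred_eq,
      integrable_withDensity_iff_integrable_smul hmeas]
    refine (integrableOn_rpow_mul_exp_neg_mul_rpow (s := a - 1) (p := 1) (b := -b) (by linarith)
      one_pos (neg_pos.mpr hb)).congr_fun (fun u hu ↦ ?_) measurableSet_Ioi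
    simp [NNReal.smul_def, Real.coe_toNNReal _ (rpow_nonneg (le_of_lt hu) (a - 1))]
  have hU : {w : ℂ | w.re < 0} ⊆
      {w | w.re ∈ interior (ProbabilityTheory.integrableExpSet id μ)} :=
    fun w hw ↦ interior_maximal hset isOpen_Iio hw
  have hopen : IsOpen {w : ℂ | w.re < 0} := isOpen_lt Complex.continuous_re continuous_const
  have hleft := (ProbabilityTheory.analyticOnNhd_complexMGF (X := id) (μ := μ)).mono hU
  have hright : AnalyticOnNhd ℂ (fun w : ℂ ↦ (-w)⁻¹ ^ (a : ℂ) * Real.Gamma a)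
      {w : ℂ | w.re < 0} := by
    refine DifferentiableOn.analyticOnNhd (fun w hw ↦ ?_) hopen
    have hw' : 0 < (-w).re := by simpa using hw
    have hw0 : -w ≠ 0 := fun h ↦ by simp [h] at hw'
    refine DifferentiableAt.differentiableWithinAt ?_
    refine ((differentiableAt_id.neg.inv hw0).cpow_const (Or.inl ?_)).mul_const _
    change 0 < (-w)⁻¹.re
    rw [Complex.inv_re]
    exact div_pos hw' (Complex.normSq_pos.mpr hw0)
  have hreal (b : ℝ) (hb : b < 0) : ProbabilityTheory.complexMGF id μ b =
      (-(b : ℂ))⁻¹ ^ (a : ℂ) * Real.Gamma a := by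
    have h := Complex.integral_cpow_mul_exp_neg_mul_Ioi (a := a) (r := -b) (by simpa using ha)
      (neg_pos.mpr hb)
    rw [one_div, Complex.ofReal_neg, Complex.Gamma_ofReal] at h
    rw [hmgf, ← h]
    refine setIntegral_congr_fun measurableSet_Ioi fun u hu ↦ ?_
    simp [Complex.ofReal_cpow (le_of_lt hu)]
  have hfreq : ∃ᶠ w in 𝓝[≠] (-1 : ℂ), ProbabilityTheory.complexMGF id μ w =
      (-w)⁻¹ ^ (a : ℂ) * Real.Gamma a := by
    have htend : Tendsto (fun b : ℝ ↦ (b : ℂ)) (𝓝[≠] (-1)) (𝓝[≠] (-1 : ℂ)) := by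
      refine tendsto_nhdsWithin_iff.mpr ⟨?_, ?_⟩
      · exact tendsto_nhdsWithin_of_tendsto_nhds
          (Complex.continuous_ofReal.tendsto' _ _ (by simp))
      · refine eventually_nhdsWithin_of_forall fun b hb h ↦ hb ?_
        exact_mod_cast (show (b : ℂ) = -1 from h)
    refine htend.frequently (Eventually.frequently ?_)
    exact (eventually_nhdsWithin_of_eventually_nhds (Iio_mem_nhds (by norm_num))).mono hreal
  rw [← hmgf]
  exact hleft.eqOn_of_preconnected_of_frequently_eq hright
    (convex_halfSpace_re_lt 0).isPreconnected (by simp) hfreq hz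

lemma integral_rpow_mul_exp_mul_exp_mul_I {θ a : ℝ} (hθ : θ ∈ Ioo (π / 2) π) (ha : 0 < a) :
    ∫ u in Ioi (0 : ℝ), ((u ^ (a - 1) : ℝ) : ℂ) * Complex.exp (u * Complex.exp (θ * Complex.I)) =
      Complex.exp ((a * (π - θ) : ℝ) * Complex.I) * Real.Gamma a := by
  have hcos : cos θ < 0 := cos_neg_of_pi_div_two_lt_of_lt hθ.1 (by linarith [hθ.2, pi_pos])
  have h := integral_rpow_mul_cexp ha (z := Complex.exp (θ * Complex.I))
    (by rw [Complex.exp_ofReal_mul_I_re]; exact hcos)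
  have hinv : (-Complex.exp (θ * Complex.I))⁻¹ = Complex.exp ((π - θ : ℝ) * Complex.I) := by
    rw [inv_neg, ← Complex.exp_neg]
    push_cast
    rw [sub_mul, sub_eq_add_neg, Complex.exp_add, Complex.exp_pi_mul_I]
    ring
  rw [hinv, Complex.cpow_def_of_ne_zero (Complex.exp_ne_zero _), Complex.log_exp] at h
  · simp_rw [mul_comm _ (Complex.exp (θ * Complex.I))]
    rw [h]
    congr 2
    push_cast
    ring
  · simp; linarith [hθ.1, hθ.2, pi_pos]
  · simp; linarith [hθ.1, hθ.2, pi_pos]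

lemma inv_Gamma_neg {y : ℝ} (hy : 0 ≤ y) :
    (Real.Gamma (-y))⁻¹ = -(Real.Gamma (y + 1) * sin (π * y)) / π := by
  have h := Real.Gamma_mul_Gamma_one_sub (-y)
  rw [sub_neg_eq_add, add_comm 1 y, mul_neg, sin_neg] at h
  have hpos : 0 < Real.Gamma (y + 1) := Gamma_pos_of_pos (by linarith)
  by_cases hs : sin (π * y) = 0
  · rw [hs, neg_zero, div_zero] at h
    have : Real.Gamma (-y) = 0 := (mul_eq_zero.mp h).resolve_right hpos.ne'
    simp [this, hs]
  · have hG : Real.Gamma (-y) ≠ 0 := by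
      intro h0
      rw [h0, zero_mul] at h
      exact div_ne_zero pi_ne_zero (neg_ne_zero.mpr hs) h.symm
    have hpi := pi_ne_zero
    rw [eq_div_iff (neg_ne_zero.mpr hs)] at h
    rw [inv_eq_one_div, div_eq_div_iff hG hpi]
    linarith

/-- The Wright series as a Hankel-type integral along a ray in the left half-plane. -/
lemma hasSum_wright {α θ : ℝ} (hα : α ∈ Ioo (0 : ℝ) 1) (x : ℝ) (hθ : θ ∈ Ioo (π / 2) π) :
    HasSum (fun k : ℕ ↦ (-x) ^ k / (k.factorial * Real.Gamma (-(α * k))))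
      ((∫ u in Ioi (0 : ℝ), wrightRay α x θ u).im / π) := by
  have hcos : cos θ < 0 := cos_neg_of_pi_div_two_lt_of_lt hθ.1 (by linarith [hθ.2, pi_pos])
  let F : ℕ → ℝ → ℂ := fun k u ↦ Complex.exp (θ * Complex.I) *
    Complex.exp (u * Complex.exp (θ * Complex.I)) *
    ((-(x * (u ^ α : ℝ) * Complex.exp ((α * θ : ℝ) * Complex.I))) ^ k / k.factorial)
  let B : ℕ → ℝ → ℝ := fun k u ↦ exp (u * cos θ) * ((|x| * u ^ α) ^ k / k.factorial)
  have hB (u : ℝ) : HasSum (fun k ↦ B k u) (exp (|x| * u ^ α - -cos θ * u)) := by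
    have h := (NormedSpace.expSeries_div_hasSum_exp (|x| * u ^ α)).mul_left (exp (u * cos θ))
    rw [← Real.exp_eq_exp_ℝ, ← exp_add] at h
    rwa [show |x| * u ^ α - -cos θ * u = u * cos θ + |x| * u ^ α by ring]
  have hF (u : ℝ) : HasSum (fun k ↦ F k u) (wrightRay α x θ u) := by
    have h := (NormedSpace.expSeries_div_hasSum_exp
      (-(x * (u ^ α : ℝ) * Complex.exp ((α * θ : ℝ) * Complex.I)))).mul_left
        (Complex.exp (θ * Complex.I) * Complex.exp (u * Complex.exp (θ * Complex.I)))
    rw [← Complex.exp_eq_exp_ℂ] at h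
    rwa [wrightRay, sub_eq_add_neg, Complex.exp_add, ← mul_assoc]
  have hcont : Continuous fun u : ℝ ↦ u ^ α := Real.continuous_rpow_const hα.1.le
  have hsum := hasSum_integral_of_dominated_convergence (μ := volume.restrict (Ioi (0 : ℝ)))
    (F := F) (f := wrightRay α x θ) B
    (fun k ↦ (by unfold F; fun_prop : Continuous (F k)).aestronglyMeasurable)
    (fun k ↦ by
      filter_upwards [ae_restrict_mem measurableSet_Ioi] with u hu
      have hu0 : 0 ≤ u ^ α := rpow_nonneg (le_of_lt hu) α
      refine le_of_eq ?_
      simp only [F, B, norm_mul, norm_div, norm_pow, norm_neg, Complex.norm_exp,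
        Complex.re_ofReal_mul, Complex.exp_ofReal_mul_I_re, Complex.norm_real,
        Complex.norm_natCast, Real.norm_eq_abs, abs_of_nonneg hu0]
      simp)
    (ae_of_all _ fun u ↦ (hB u).summable)
    (by
      simp only [fun u ↦ (hB u).tsum_eq]
      exact integrableOn_exp_rpow_sub_mul hα |x| (by linarith))
    (ae_of_all _ hF)
  have him := ((Complex.hasSum_im hsum).div_const π)
  refine him.congr_fun fun k ↦ ?_
  have hk : 0 ≤ α * k := by have := hα.1; positivity
  have hint : ∫ u in Ioi (0 : ℝ), F k u =
      (((-x) ^ k / k.factorial * Real.Gamma (α * k + 1) : ℝ) : ℂ) *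
        Complex.exp ((π + π * (α * k) : ℝ) * Complex.I) := by
    have h : ∀ u ∈ Ioi (0 : ℝ), F k u =
        ((((-x) ^ k / k.factorial : ℝ) : ℂ) * Complex.exp ((θ * (α * k + 1) : ℝ) * Complex.I)) *
          (((u ^ (α * k + 1 - 1) : ℝ) : ℂ) *
            Complex.exp (u * Complex.exp (θ * Complex.I))) := by
      intro u hu
      have hpow : u ^ (α * k + 1 - 1) = (u ^ α) ^ k := by
        rw [add_sub_cancel_right, rpow_mul (le_of_lt hu), rpow_natCast]
      have hexp : Complex.exp ((θ * (α * k + 1) : ℝ) * Complex.I) =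
          Complex.exp (θ * Complex.I) * Complex.exp ((α * θ : ℝ) * Complex.I) ^ k := by
        rw [← Complex.exp_nat_mul, ← Complex.exp_add]
        congr 1
        push_cast
        ring
      simp only [F]
      rw [hpow, hexp, ← neg_mul, ← neg_mul, mul_pow, mul_pow]
      push_cast
      ring
    rw [setIntegral_congr_fun measurableSet_Ioi h, integral_const_mul,
      integral_rpow_mul_exp_mul_exp_mul_I hθ (by linarith),
      show (((π + π * (α * k) : ℝ) : ℂ) * Complex.I) = (θ * (α * k + 1) : ℝ) * Complex.I +
        ((α * k + 1) * (π - θ) : ℝ) * Complex.I by push_cast; ring, Complex.exp_add]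
    push_cast
    ring
  rw [hint, Complex.im_ofReal_mul, Complex.exp_ofReal_mul_I_im, add_comm π, sin_add_pi,
    div_mul_eq_div_div, div_eq_mul_inv _ (Real.Gamma _), inv_Gamma_neg hk]
  ring

lemma abs_im_integral_Ioi_wrightRay_le {α x θ r : ℝ} (hα : α ∈ Ioo (0 : ℝ) 1) (hx : 0 ≤ x)
    (hθ : θ ∈ Ioo (π / 2) π) (hαθ : α * θ ≤ π / 2) (hr : 0 < r) :
    |(∫ u in Ioi (0 : ℝ), wrightRay α x θ u).im| ≤
      θ * (r * exp (r - x * r ^ α * cos (α * θ))) +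
        exp (-(x * r ^ α * cos (α * θ))) / -cos θ := by
  have hcos : cos θ < 0 := cos_neg_of_pi_div_two_lt_of_lt hθ.1 (by linarith [hθ.2, pi_pos])
  have hθ0 : 0 ≤ θ := by linarith [hθ.1, pi_pos]
  have hc : 0 ≤ cos (α * θ) :=
    cos_nonneg_of_neg_pi_div_two_le_of_le (by nlinarith [pi_pos, hα.1]) hαθ
  have hcont := continuous_wrightRay hα.1.le x θ
  have hdecay (R u : ℝ) (hR : 0 ≤ R) (hu : u ∈ Ioi R) :
      ‖wrightRay α x θ u‖ ≤ exp (-(x * R ^ α * cos (α * θ))) * exp (cos θ * u) := by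
    rw [norm_wrightRay, ← exp_add, exp_le_exp]
    have h1 : R ^ α ≤ u ^ α := rpow_le_rpow hR (le_of_lt hu) hα.1.le
    have h2 := mul_le_mul_of_nonneg_left h1 (mul_nonneg hx hc)
    linarith
  have hdom (R : ℝ) : IntegrableOn
      (fun u ↦ exp (-(x * R ^ α * cos (α * θ))) * exp (cos θ * u)) (Ioi R) :=
    (integrableOn_exp_mul_Ioi hcos R).const_mul _
  have hint (R : ℝ) (hR : 0 ≤ R) : IntegrableOn (wrightRay α x θ) (Ioi R) :=
    (hdom R).mono' hcont.aestronglyMeasurable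
      ((ae_restrict_mem measurableSet_Ioi).mono fun u hu ↦ hdecay R u hR hu)
  have htail : ‖∫ u in Ioi r, wrightRay α x θ u‖ ≤
      exp (-(x * r ^ α * cos (α * θ))) / -cos θ := by
    refine (norm_integral_le_of_norm_le (hdom r)
      ((ae_restrict_mem measurableSet_Ioi).mono fun u hu ↦ hdecay r u hr.le hu)).trans ?_
    rw [integral_const_mul, integral_exp_mul_Ioi hcos, neg_div, ← div_neg, div_eq_mul_one_div,
      div_eq_mul_one_div (exp (-_))]
    refine mul_le_mul_of_nonneg_left ?_ (exp_pos _).le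
    refine mul_le_of_le_one_left (by rw [one_div, inv_nonneg]; linarith) ?_
    exact exp_le_one_iff.mpr (mul_nonpos_of_nonpos_of_nonneg hcos.le hr.le)
  have hstart (ε : ℝ) (hε : 0 < ε) : ‖∫ u in (0 : ℝ)..ε, wrightRay α x θ u‖ ≤ ε := by
    have := intervalIntegral.norm_integral_le_of_norm_le_const (a := 0) (b := ε)
      (f := wrightRay α x θ) (C := 1) fun u hu ↦ by
        rw [uIoc_of_le hε.le] at hu
        rw [norm_wrightRay, exp_le_one_iff]
        have h1 : u * cos θ ≤ 0 := mul_nonpos_of_nonneg_of_nonpos hu.1.le hcos.le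
        have h2 : 0 ≤ x * u ^ α * cos (α * θ) :=
          mul_nonneg (mul_nonneg hx (rpow_nonneg hu.1.le α)) hc
        linarith
    rwa [sub_zero, abs_of_pos hε, one_mul] at this
  have key (ε : ℝ) (hε : 0 < ε) : |(∫ u in Ioi (0 : ℝ), wrightRay α x θ u).im| ≤
      θ * (r * exp (r - x * r ^ α * cos (α * θ))) +
        exp (-(x * r ^ α * cos (α * θ))) / -cos θ + (ε + θ * (ε * exp ε)) := by
    have hsplit : ∫ u in Ioi (0 : ℝ), wrightRay α x θ u =
        (∫ u in (0 : ℝ)..ε, wrightRay α x θ u) + (∫ u in ε..r, wrightRay α x θ u) +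
          ∫ u in Ioi r, wrightRay α x θ u := by
      rw [intervalIntegral.integral_add_adjacent_intervals (hcont.intervalIntegrable _ _)
        (hcont.intervalIntegrable _ _),
        intervalIntegral.integral_interval_add_Ioi (hint 0 le_rfl) (hint r hr.le)]
    rw [hsplit, Complex.add_im, Complex.add_im]
    have h1 := (Complex.abs_im_le_norm _).trans (hstart ε hε)
    have h2 := abs_im_integral_wrightRay_le hα hx hθ0 hαθ hε hr
    have h3 := (Complex.abs_im_le_norm _).trans htail
    have h4 := abs_add_three (∫ u in (0 : ℝ)..ε, wrightRay α x θ u).im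
      (∫ u in ε..r, wrightRay α x θ u).im (∫ u in Ioi r, wrightRay α x θ u).im
    linarith
  have hlim : Tendsto (fun ε : ℝ ↦ θ * (r * exp (r - x * r ^ α * cos (α * θ))) +
      exp (-(x * r ^ α * cos (α * θ))) / -cos θ + (ε + θ * (ε * exp ε))) (𝓝[>] 0)
      (𝓝 (θ * (r * exp (r - x * r ^ α * cos (α * θ))) +
        exp (-(x * r ^ α * cos (α * θ))) / -cos θ)) := by
    refine tendsto_nhdsWithin_of_tendsto_nhds (Continuous.tendsto' (by fun_prop) _ _ (by simp))
  exact ge_of_tendsto hlim (eventually_nhdsWithin_of_forall key)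

lemma exists_wright_series_bound {α : ℝ} (hα : α ∈ Ioo (0 : ℝ) 1) :
    ∃ C : ℝ, 0 < C ∧ ∃ c : ℝ, 0 < c ∧ ∀ x : ℝ, 0 < x →
      |∑' k : ℕ, (-x) ^ (k + 1) / ((k + 1).factorial * Real.Gamma (-(α * (k + 1))))| ≤
        C * exp (-c * x ^ ((1 : ℝ) / (1 - α))) := by
  obtain ⟨hα0, hα1⟩ := hα
  have hπ := pi_pos
  set θ : ℝ := π / (1 + α) with hθdef
  have hθ : θ ∈ Ioo (π / 2) π :=
    ⟨div_lt_div_of_pos_left hπ (by linarith) (by linarith), div_lt_self hπ (by linarith)⟩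
  have hαθ : α * θ < π / 2 := by
    have : θ + α * θ = π := by rw [hθdef]; field_simp
    linarith [hθ.1]
  have hθ0 : 0 < θ := by linarith [hθ.1]
  have hcos : cos θ < 0 := cos_neg_of_pi_div_two_lt_of_lt hθ.1 (by linarith [hθ.2])
  have hc : 0 < cos (α * θ) := cos_pos_of_mem_Ioo ⟨by nlinarith, hαθ⟩
  set p : ℝ := (1 : ℝ) / (1 - α) with hp
  refine ⟨(θ * 2 + 1 / -cos θ) / π, ?_, (cos (α * θ) / 2) ^ p / 2, by positivity, ?_⟩
  · have : 0 < 1 / -cos θ := one_div_pos.mpr (by linarith)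
    positivity
  intro x hx
  set r : ℝ := (cos (α * θ) / 2 * x) ^ p with hrdef
  have hbase : 0 < cos (α * θ) / 2 * x := by positivity
  have hr : 0 < r := rpow_pos_of_pos hbase p
  have hexp : x * r ^ α * cos (α * θ) = 2 * r := by
    have h1 : r ^ (1 - α) = cos (α * θ) / 2 * x := by
      rw [hrdef, ← rpow_mul hbase.le, hp, one_div_mul_cancel (by linarith), rpow_one]
    have h2 : r ^ (1 - α) * r ^ α = r := by
      rw [← rpow_add hr, sub_add_cancel, rpow_one]
    rw [h1] at h2
    linarith
  have htsum : ∑' k : ℕ, (-x) ^ (k + 1) / ((k + 1).factorial * Real.Gamma (-(α * (k + 1)))) =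
      (∫ u in Ioi (0 : ℝ), wrightRay α x θ u).im / π := by
    have h := hasSum_wright ⟨hα0, hα1⟩ x hθ
    have h' := (hasSum_nat_add_iff' 1).mpr h
    simpa using h'.tsum_eq
  have hbound := abs_im_integral_Ioi_wrightRay_le ⟨hα0, hα1⟩ hx.le hθ hαθ.le hr
  rw [hexp] at hbound
  have hrexp : r * exp (r - 2 * r) ≤ 2 * exp (-(r / 2)) := by
    have h1 : r / 2 ≤ exp (r / 2) := by linarith [add_one_le_exp (r / 2)]
    have h2 : exp (r - 2 * r) = exp (-(r / 2)) * exp (-(r / 2)) := by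
      rw [← exp_add]; ring_nf
    have h3 : exp (r / 2) * exp (-(r / 2)) = 1 := by rw [← exp_add, add_neg_cancel, exp_zero]
    have h4 := exp_pos (-(r / 2))
    have h5 := mul_le_mul_of_nonneg_right h1 h4.le
    rw [h2]
    nlinarith
  have htail : exp (-(2 * r)) / -cos θ ≤ 1 / -cos θ * exp (-(r / 2)) := by
    rw [one_div_mul_eq_div]
    exact div_le_div_of_nonneg_right (exp_le_exp.mpr (by linarith)) (by linarith)
  have hr_eq : -((cos (α * θ) / 2) ^ p / 2) * x ^ p = -(r / 2) := by
    rw [hrdef, mul_rpow (by positivity) hx.le]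
    ring
  rw [htsum, hr_eq, abs_div, abs_of_pos hπ, div_mul_eq_mul_div]
  refine div_le_div_of_nonneg_right ?_ hπ.le
  nlinarith [mul_le_mul_of_nonneg_left hrexp hθ0.le]

/-- There exist constants `C, c > 0` depending only on `α` such that for all `s, t > 0`,
`|ψ_{t,α}(s)| ≤ C t⁻¹ exp(-c (s t^{-α})^{1/(1-α)})`. -/
theorem psiSub_bound
    (α : ℝ) (hα : α ∈ Set.Ioo (0 : ℝ) 1) :
    ∃ C : ℝ, 0 < C ∧ ∃ c : ℝ, 0 < c ∧ ∀ s t : ℝ, 0 < s → 0 < t →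
      |psiSub α t s| ≤
        C * t⁻¹ * Real.exp (-c * (s * t ^ (-α)) ^ ((1:ℝ) / (1 - α))) := by
  obtain ⟨C, hC, c, hc, h⟩ := exists_wright_series_bound hα
  refine ⟨C, hC, c, hc, fun s t hs ht ↦ ?_⟩
  rw [psiSub, abs_mul, abs_of_pos (inv_pos.mpr ht), mul_comm C, mul_assoc]
  exact mul_le_mul_of_nonneg_left (h _ (mul_pos hs (rpow_pos_of_pos ht _)))
    (inv_pos.mpr ht).le
end

section
/- There exist constants C, c > 0, depending only on α, such that for all s > 0 and t > 0, |ν_{t,α}(s)| ≤ C t^{−α−1} exp( −c (s t^{−α})^{1/(1−α)} ). -/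
open Real

/-- `ν_{t,α}(s) = t^{-α-1} ∑_{k=0}^∞ (-s t^{-α})^k / (k! Γ(-α - α k))`,
the Wright function `t^{-α-1} ₀Ψ₁[ -; (-α,-α) | -s t^{-α} ]`, with the convention
`1/Γ = 0` at the poles (note `Real.Gamma` vanishes at nonpositive integers). -/
noncomputable def nuSub (α t s : ℝ) : ℝ :=
  t ^ (-α - 1) * ∑' k : ℕ, (-(s * t ^ (-α))) ^ k /
    (k.factorial * Real.Gamma (-α - α * k))

open MeasureTheory Filter Topology

theorem integrable_exp_neg_mul_exp_add {d A : ℝ} (hd : 0 < d) (hA : 0 < A) :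
    Integrable fun u : ℝ => rexp (-d * rexp u + A * u) := by
  have h := integrableOn_rpow_mul_exp_neg_mul_rpow (p := 1) (s := A - 1) (b := d)
    (by linarith) one_pos hd
  have himg : rexp '' Set.univ = Set.Ioi 0 := by rw [Set.image_univ, Real.range_exp]
  rw [← himg, integrableOn_image_iff_integrableOn_abs_deriv_smul MeasurableSet.univ
    (fun x _ => (Real.hasDerivAt_exp x).hasDerivWithinAt) Real.exp_injective.injOn,
    integrableOn_univ] at h
  refine h.congr (Eventually.of_forall fun u => ?_)
  simp only [abs_of_pos (Real.exp_pos u), smul_eq_mul, Real.rpow_one]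
  rw [← Real.exp_mul, ← Real.exp_add, ← Real.exp_add]
  ring_nf

theorem integral_exp_neg_exp_add {A : ℝ} (hA : 0 < A) :
    ∫ u : ℝ, rexp (-rexp u + A * u) = Real.Gamma A := by
  have himg : rexp '' Set.univ = Set.Ioi 0 := by rw [Set.image_univ, Real.range_exp]
  rw [Real.Gamma_eq_integral hA, ← himg, integral_image_eq_integral_abs_deriv_smul MeasurableSet.univ
    (fun x _ => (Real.hasDerivAt_exp x).hasDerivWithinAt) Real.exp_injective.injOn,
    setIntegral_univ]
  congr 1 with u
  simp only [abs_of_pos (Real.exp_pos u), smul_eq_mul]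
  rw [← Real.exp_mul, ← Real.exp_add, ← Real.exp_add]
  ring_nf

/-- Comparison of the integrals of an entire function over two horizontal segments. -/
theorem norm_integral_horizontal_sub_le {F : ℂ → ℂ} (hF : Differentiable ℂ F) {a b v θ M N : ℝ}
    (hM : ∀ y ∈ Set.uIoc v θ, ‖F (a + y * Complex.I)‖ ≤ M)
    (hN : ∀ y ∈ Set.uIoc v θ, ‖F (b + y * Complex.I)‖ ≤ N) :
    ‖(∫ u in a..b, F (u + θ * Complex.I)) - ∫ u in a..b, F (u + v * Complex.I)‖
      ≤ (M + N) * |θ - v| := by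
  have h := Complex.integral_boundary_rect_eq_zero_of_differentiableOn F
    (a + v * Complex.I) (b + θ * Complex.I) hF.differentiableOn
  simp only [Complex.add_re, Complex.add_im, Complex.ofReal_re, Complex.ofReal_im,
    Complex.mul_re, Complex.mul_im, Complex.I_re, Complex.I_im, mul_zero, mul_one, sub_zero,
    zero_add, add_zero] at h
  have h1 := intervalIntegral.norm_integral_le_of_norm_le_const hM
  have h2 := intervalIntegral.norm_integral_le_of_norm_le_const hN
  have : (∫ u in a..b, F (u + θ * Complex.I)) - ∫ u in a..b, F (u + v * Complex.I)
      = Complex.I • (∫ y in v..θ, F (b + y * Complex.I))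
        - Complex.I • (∫ y in v..θ, F (a + y * Complex.I)) := by
    linear_combination -h
  rw [this]
  refine (norm_sub_le _ _).trans ?_
  rw [norm_smul, norm_smul, Complex.norm_I, one_mul, one_mul]
  linarith

theorem exp_re_horizontal (u v a : ℝ) :
    (Complex.exp (a * (u + v * Complex.I))).re = rexp (a * u) * Real.cos (a * v) := by
  rw [Complex.exp_re]
  simp

theorem integral_cexp_neg_cexp_add {A φ : ℝ} (hA : 0 < A) (hφ : φ ∈ Set.Ioo (-(π / 2)) (π / 2)) :
    ∫ u : ℝ, Complex.exp (-Complex.exp (u + φ * Complex.I) + A * (u + φ * Complex.I))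
      = Real.Gamma A := by
  set F : ℂ → ℂ := fun w => Complex.exp (-Complex.exp w + A * w) with hFdef
  have hF : Differentiable ℂ F := by fun_prop
  have hnorm : ∀ u y : ℝ, ‖F (u + y * Complex.I)‖ = rexp (-Real.cos y * rexp u + A * u) := by
    intro u y
    have h1 := exp_re_horizontal u y 1
    rw [hFdef, Complex.norm_exp]
    simp only [Complex.ofReal_one, one_mul] at h1
    simp [h1]
    ring
  have hd : 0 < Real.cos φ := Real.cos_pos_of_mem_Ioo hφ
  have hint : ∀ y : ℝ, 0 < Real.cos y → Integrable fun u : ℝ => F (u + y * Complex.I) := by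
    intro y hy
    refine (integrable_exp_neg_mul_exp_add hy hA).mono' ?_
      (Eventually.of_forall fun u => (hnorm u y).le)
    exact (by fun_prop : Continuous fun u : ℝ => F (u + y * Complex.I)).aestronglyMeasurable
  have hcos : ∀ y ∈ Set.uIoc 0 φ, Real.cos φ ≤ Real.cos y := by
    intro y hy
    rw [← Real.cos_abs φ, ← Real.cos_abs y]
    apply Real.cos_le_cos_of_nonneg_of_le_pi (abs_nonneg _)
    · have := abs_le.2 ⟨hφ.1.le, hφ.2.le⟩
      linarith [Real.pi_pos]
    · have := Set.abs_sub_left_of_mem_uIcc (Set.uIoc_subset_uIcc hy)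
      simpa using this
  have hlim : ∀ y : ℝ, 0 < Real.cos y → Tendsto (fun n : ℝ => ∫ u in (-n)..n, F (u + y * Complex.I))
      atTop (𝓝 (∫ u : ℝ, F (u + y * Complex.I))) := fun y hy =>
    intervalIntegral_tendsto_integral (hint y hy) tendsto_neg_atTop_atBot tendsto_id
  have hbd : ∀ n : ℝ, ‖(∫ u in (-n)..n, F (u + φ * Complex.I))
      - ∫ u in (-n)..n, F (u + (0 : ℝ) * Complex.I)‖
      ≤ (rexp (-A * n) + rexp (-Real.cos φ * rexp n + A * n)) * |φ - 0| := by
    intro n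
    apply norm_integral_horizontal_sub_le hF
    · intro y hy
      rw [hnorm]
      have := hcos y hy
      have h2 := mul_pos (hd.trans_le this) (Real.exp_pos (-n))
      apply Real.exp_le_exp.2
      linarith
    · intro y hy
      rw [hnorm]
      have := mul_le_mul_of_nonneg_right (hcos y hy) (Real.exp_pos n).le
      apply Real.exp_le_exp.2
      linarith
  have hzero : Tendsto (fun n : ℝ => (rexp (-A * n) + rexp (-Real.cos φ * rexp n + A * n))
      * |φ - 0|) atTop (𝓝 0) := by
    have t1 : Tendsto (fun n : ℝ => rexp (-A * n)) atTop (𝓝 0) :=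
      Real.tendsto_exp_atBot.comp (tendsto_id.const_mul_atTop_of_neg (by linarith))
    have t2 : Tendsto (fun n : ℝ => rexp (-Real.cos φ * rexp n + A * n)) atTop (𝓝 0) := by
      have := (tendsto_rpow_mul_exp_neg_mul_atTop_nhds_zero A (Real.cos φ) hd).comp
        Real.tendsto_exp_atTop
      refine this.congr fun n => ?_
      simp only [Function.comp]
      rw [← Real.exp_mul, ← Real.exp_add]
      ring_nf
    simpa using (t1.add t2).mul_const |φ - 0|
  have := tendsto_nhds_unique ((hlim φ hd).sub (hlim 0 (by simp))) (squeeze_zero_norm hbd hzero)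
  rw [sub_eq_zero.1 this, ← integral_exp_neg_exp_add hA, ← integral_complex_ofReal]
  congr 1 with u
  simp [hFdef]

theorem one_div_Gamma_neg {a : ℝ} (ha : 0 < a) :
    1 / Real.Gamma (-a) =
      1 / π * (Complex.exp (π * (a + 1) * Complex.I) * Real.Gamma (a + 1)).im := by
  have h := Real.Gamma_mul_Gamma_one_sub (-a)
  have hpos : 0 < Real.Gamma (a + 1) := Real.Gamma_pos_of_pos (by linarith)
  have him : (Complex.exp (π * (a + 1) * Complex.I) * Real.Gamma (a + 1)).im
      = Real.sin (π * -a) * Real.Gamma (a + 1) := by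
    rw [Complex.im_mul_ofReal]
    congr 1
    have := Complex.exp_ofReal_mul_I_im (π * (a + 1))
    push_cast at this
    rw [this, mul_add, mul_one, Real.sin_add_pi, mul_neg, Real.sin_neg]
  rw [him]
  rw [show 1 - -a = a + 1 by ring] at h
  rw [eq_div_of_mul_eq hpos.ne' h]
  field_simp

theorem integral_cexp_cexp_add {A θ : ℝ} (hA : 0 < A) (hθ : θ ∈ Set.Ioo (π / 2) π) :
    ∫ u : ℝ, Complex.exp (Complex.exp (u + θ * Complex.I) + A * (u + θ * Complex.I))
      = Complex.exp (π * A * Complex.I) * Real.Gamma A := by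
  have hφ : θ - π ∈ Set.Ioo (-(π / 2)) (π / 2) :=
    ⟨by linarith [hθ.1], by linarith [hθ.2, Real.pi_pos]⟩
  rw [← integral_cexp_neg_cexp_add hA hφ, ← integral_const_mul]
  congr 1 with u
  rw [← Complex.exp_add]
  have : (u + θ * Complex.I : ℂ) = (u + (θ - π : ℝ) * Complex.I) + π * Complex.I := by
    push_cast; ring
  rw [this, Complex.exp_add_pi_mul_I]
  ring_nf

/-- The integrand of the Hankel-type representation of the Wright function, in logarithmic
coordinates. -/
noncomputable def wrightIntegrand (α x : ℝ) (w : ℂ) : ℂ :=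
  Complex.exp (Complex.exp w + (1 + α) * w - x * Complex.exp (α * w))

theorem differentiable_wrightIntegrand (α x : ℝ) : Differentiable ℂ (wrightIntegrand α x) := by
  unfold wrightIntegrand
  fun_prop

theorem norm_wrightIntegrand (α x u v : ℝ) :
    ‖wrightIntegrand α x (u + v * Complex.I)‖ =
      rexp (rexp u * Real.cos v + (1 + α) * u - x * (rexp (α * u) * Real.cos (α * v))) := by
  have h1 := exp_re_horizontal u v 1
  have h2 := exp_re_horizontal u v α
  simp only [Complex.ofReal_one, one_mul] at h1
  rw [wrightIntegrand, Complex.norm_exp, Complex.sub_re, Complex.add_re, h1, Complex.re_ofReal_mul,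
    h2]
  congr 3
  have : (1 + α : ℂ) = ((1 + α : ℝ) : ℂ) := by push_cast; rfl
  rw [this, Complex.re_ofReal_mul]
  simp

theorem exists_mul_exp_mul_le {α x ε : ℝ} (hα : α ∈ Set.Ioo (0 : ℝ) 1) (hx : 0 < x)
    (hε : 0 < ε) : ∃ M : ℝ, ∀ u : ℝ, x * rexp (α * u) ≤ ε * rexp u + M := by
  have h1 : 0 < 1 - α := by linarith [hα.2]
  set u₀ : ℝ := Real.log (x / ε) / (1 - α)
  refine ⟨x * rexp (α * u₀), fun u => ?_⟩
  rcases le_total u₀ u with h | h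
  · have h2 : Real.log (x / ε) ≤ (1 - α) * u := by
      rw [div_le_iff₀ h1] at h
      linarith
    have h3 : x / ε ≤ rexp ((1 - α) * u) := by
      rw [← Real.exp_log (div_pos hx hε)]
      exact Real.exp_le_exp.2 h2
    rw [div_le_iff₀ hε] at h3
    have h4 := mul_le_mul_of_nonneg_right h3 (Real.exp_pos (α * u)).le
    have h5 : rexp ((1 - α) * u) * rexp (α * u) = rexp u := by
      rw [← Real.exp_add]; ring_nf
    have h6 : 0 < x * rexp (α * u₀) := by positivity
    nlinarith
  · have : rexp (α * u) ≤ rexp (α * u₀) :=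
      Real.exp_le_exp.2 (mul_le_mul_of_nonneg_left h hα.1.le)
    have := mul_le_mul_of_nonneg_left this hx.le
    have := mul_pos hε (Real.exp_pos u)
    linarith

/-- Hankel-type representation of the Wright function. -/
theorem hasSum_integral_wrightIntegrand {α x θ : ℝ} (hα : α ∈ Set.Ioo (0 : ℝ) 1) (hx : 0 < x)
    (hθ : θ ∈ Set.Ioo (π / 2) π) :
    HasSum (fun k : ℕ => (-x) ^ k / (k.factorial * Real.Gamma (-α - α * k)))
      (1 / π * (∫ u : ℝ, wrightIntegrand α x (u + θ * Complex.I)).im) := by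
  have hd : 0 < -Real.cos θ := by
    linarith [Real.cos_neg_of_pi_div_two_lt_of_lt hθ.1 (by linarith [hθ.2, Real.pi_pos])]
  have hsum : HasSum (fun k : ℕ => ∫ u : ℝ, ((-x) ^ k / k.factorial : ℝ) *
      Complex.exp (Complex.exp (u + θ * Complex.I)
        + (α * (k + 1) + 1 : ℝ) * (u + θ * Complex.I)))
      (∫ u : ℝ, wrightIntegrand α x (u + θ * Complex.I)) := by
    have hb : ∀ u : ℝ, HasSum (fun k : ℕ => (x * rexp (α * u)) ^ k / k.factorial *
        rexp (rexp u * Real.cos θ + (1 + α) * u))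
        (rexp (x * rexp (α * u)) * rexp (rexp u * Real.cos θ + (1 + α) * u)) := by
      intro u
      rw [Real.exp_eq_exp_ℝ]
      exact (NormedSpace.expSeries_div_hasSum_exp (x * NormedSpace.exp (α * u))).mul_right _
    refine hasSum_integral_of_dominated_convergence
      (fun (k : ℕ) (u : ℝ) => (x * rexp (α * u)) ^ k / k.factorial *
        rexp (rexp u * Real.cos θ + (1 + α) * u)) ?_ ?_ ?_ ?_ ?_
    · intro k
      exact (by fun_prop : Continuous _).aestronglyMeasurable
    · refine fun k => Eventually.of_forall fun u => le_of_eq ?_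
      have h1 := exp_re_horizontal u θ 1
      simp only [Complex.ofReal_one, one_mul] at h1
      rw [norm_mul, Complex.norm_exp, Complex.add_re, h1, Complex.re_ofReal_mul,
        Complex.norm_real, norm_div, norm_pow, norm_neg, Real.norm_of_nonneg hx.le,
        Real.norm_of_nonneg (Nat.cast_nonneg _), mul_pow, ← Real.exp_nat_mul, mul_div_right_comm,
        mul_assoc, ← Real.exp_add]
      congr 2
      simp
      ring
    · exact Eventually.of_forall fun u => (hb u).summable
    · simp_rw [fun u => (hb u).tsum_eq]
      obtain ⟨M, hM⟩ := exists_mul_exp_mul_le hα hx (half_pos hd)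
      refine ((integrable_exp_neg_mul_exp_add (half_pos hd)
        (show 0 < 1 + α by linarith [hα.1])).const_mul (rexp M)).mono' ?_ ?_
      · exact (by fun_prop : Continuous _).aestronglyMeasurable
      · refine Eventually.of_forall fun u => ?_
        rw [← Real.exp_add, ← Real.exp_add, Real.norm_of_nonneg (Real.exp_pos _).le]
        apply Real.exp_le_exp.2
        linarith [hM u]
    · refine Eventually.of_forall fun u => ?_
      have := (NormedSpace.expSeries_div_hasSum_exp
        (-x * Complex.exp (α * (u + θ * Complex.I)))).mul_right
        (Complex.exp (Complex.exp (u + θ * Complex.I) + (1 + α) * (u + θ * Complex.I)))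
      rw [← Complex.exp_eq_exp_ℂ, ← Complex.exp_add] at this
      have h2 : wrightIntegrand α x (u + θ * Complex.I) =
          Complex.exp (-x * Complex.exp (α * (u + θ * Complex.I)) +
          (Complex.exp (u + θ * Complex.I) + (1 + α) * (u + θ * Complex.I))) := by
        rw [wrightIntegrand]; ring_nf
      rw [h2]
      refine this.congr_fun fun k => ?_
      rw [mul_pow, ← Complex.exp_nat_mul, mul_div_right_comm, mul_assoc, ← Complex.exp_add]
      push_cast
      ring_nf
  have him := (Complex.hasSum_im hsum).mul_left (1 / π)
  refine him.congr_fun fun k => ?_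
  have ha : 0 < α * (k + 1) := mul_pos hα.1 (by positivity)
  rw [integral_const_mul, integral_cexp_cexp_add (by linarith) hθ, Complex.im_ofReal_mul,
    mul_left_comm]
  have := one_div_Gamma_neg ha
  push_cast at this ⊢
  rw [← this, show -α - α * k = -(α * (k + 1)) by ring, div_mul_div_comm, mul_one]

theorem abs_im_integral_wrightIntegrand_le {α x θ : ℝ} (hα : α ∈ Set.Ioo (0 : ℝ) 1) (hx : 0 < x)
    (hθ : θ ∈ Set.Ioo (π / 2) π) (hαθ : α * θ < π / 2) (L : ℝ) :
    |(∫ u : ℝ, wrightIntegrand α x (u + θ * Complex.I)).im| ≤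
      θ * rexp (rexp L + (1 + α) * L - Real.cos (α * θ) * x * rexp (α * L)) +
      (∫ u : ℝ, rexp (-(-Real.cos θ) * rexp u + (1 + α) * u)) *
        rexp (-(Real.cos (α * θ) * x * rexp (α * L))) := by
  have hpi := Real.pi_pos
  have hθ0 : 0 < θ := by linarith [hθ.1]
  have hd : 0 < -Real.cos θ := by
    linarith [Real.cos_neg_of_pi_div_two_lt_of_lt hθ.1 (by linarith [hθ.2])]
  have hα1 : 0 < 1 + α := by linarith [hα.1]
  have hαθ0 : 0 < α * θ := mul_pos hα.1 hθ0
  have hc : 0 < Real.cos (α * θ) := Real.cos_pos_of_mem_Ioo ⟨by linarith, hαθ⟩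
  have hcos : ∀ y ∈ Set.uIoc 0 θ, Real.cos (α * θ) ≤ Real.cos (α * y) := by
    intro y hy
    rw [Set.uIoc_of_le hθ0.le] at hy
    exact Real.cos_le_cos_of_nonneg_of_le_pi (mul_nonneg hα.1.le hy.1.le) (by linarith)
      (mul_le_mul_of_nonneg_left hy.2 hα.1.le)
  have hK := integrable_exp_neg_mul_exp_add hd hα1
  have hF := differentiable_wrightIntegrand α x
  set G : ℝ → ℂ := fun u => wrightIntegrand α x (u + θ * Complex.I) with hG
  have hGc : Continuous G := hF.continuous.comp (by fun_prop)
  have hint : Integrable G := by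
    refine hK.mono' hGc.aestronglyMeasurable (Eventually.of_forall fun u => ?_)
    rw [hG, norm_wrightIntegrand]
    apply Real.exp_le_exp.2
    have : 0 < x * (rexp (α * u) * Real.cos (α * θ)) := by positivity
    linarith
  rw [← intervalIntegral.integral_Iic_add_Ioi hint.integrableOn hint.integrableOn (b := L),
    Complex.add_im]
  refine (abs_add_le _ _).trans (add_le_add ?_ ?_)
  · have hlim : Tendsto (fun a : ℝ => |(∫ u in a..L, G u).im|) atBot
        (𝓝 |(∫ u in Set.Iic L, G u).im|) :=
      ((Complex.continuous_im.tendsto _).comp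
        (intervalIntegral_tendsto_integral_Iic L hint.integrableOn tendsto_id)).abs
    have hlim2 : Tendsto (fun a : ℝ => (rexp (1 + (1 + α) * a) +
        rexp (rexp L + (1 + α) * L - Real.cos (α * θ) * x * rexp (α * L))) * |θ - 0|) atBot
        (𝓝 ((0 + rexp (rexp L + (1 + α) * L - Real.cos (α * θ) * x * rexp (α * L)))
          * |θ - 0|)) := by
      refine Tendsto.mul_const _ (Tendsto.add_const _ ?_)
      exact Real.tendsto_exp_atBot.comp
        (tendsto_atBot_add_const_left _ _ (tendsto_id.const_mul_atBot hα1))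
    rw [zero_add, sub_zero, abs_of_pos hθ0, mul_comm (rexp _) θ] at hlim2
    refine le_of_tendsto_of_tendsto hlim hlim2 ?_
    filter_upwards [eventually_le_atBot (0 : ℝ)] with a ha
    have hreal : (∫ u in a..L, wrightIntegrand α x (u + (0 : ℝ) * Complex.I)).im = 0 := by
      have : ∀ u : ℝ, wrightIntegrand α x (u + (0 : ℝ) * Complex.I) =
          (rexp (rexp u + (1 + α) * u - x * rexp (α * u)) : ℝ) := by
        intro u
        simp [wrightIntegrand]
      simp_rw [this, intervalIntegral.integral_ofReal, Complex.ofReal_im]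
    have hrect := norm_integral_horizontal_sub_le hF (a := a) (b := L) (v := 0) (θ := θ)
      (M := rexp (1 + (1 + α) * a))
      (N := rexp (rexp L + (1 + α) * L - Real.cos (α * θ) * x * rexp (α * L))) ?_ ?_
    · have him := (Complex.abs_im_le_norm _).trans hrect
      rwa [Complex.sub_im, hreal, sub_zero, sub_zero, abs_of_pos hθ0] at him
    · intro y hy
      rw [norm_wrightIntegrand]
      apply Real.exp_le_exp.2
      have h1 : 0 < x * (rexp (α * a) * Real.cos (α * y)) := by
        have := hc.trans_le (hcos y hy)
        positivity
      have h2 : rexp a * Real.cos y ≤ 1 := by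
        have := Real.exp_le_one_iff.2 ha
        have := Real.exp_pos a
        nlinarith [Real.cos_le_one y]
      linarith
    · intro y hy
      rw [norm_wrightIntegrand]
      apply Real.exp_le_exp.2
      have h1 := mul_le_mul_of_nonneg_left (hcos y hy)
        (by positivity : 0 ≤ x * rexp (α * L))
      have h2 : rexp L * Real.cos y ≤ rexp L :=
        mul_le_of_le_one_right (Real.exp_pos _).le (Real.cos_le_one y)
      linarith
  · refine (Complex.abs_im_le_norm _).trans ((norm_integral_le_integral_norm _).trans ?_)
    rw [← integral_mul_const]
    refine (setIntegral_mono_on hint.norm.integrableOn (hK.mul_const _).integrableOn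
      measurableSet_Ioi fun u hu => ?_).trans
      (setIntegral_le_integral (hK.mul_const _) (Eventually.of_forall fun u => by positivity))
    rw [hG, norm_wrightIntegrand, ← Real.exp_add]
    apply Real.exp_le_exp.2
    have : rexp (α * L) ≤ rexp (α * u) :=
      Real.exp_le_exp.2 (mul_le_mul_of_nonneg_left (le_of_lt hu) hα.1.le)
    have := mul_le_mul_of_nonneg_left this (by positivity : 0 ≤ Real.cos (α * θ) * x)
    linarith

theorem exp_mul_le_nine_mul_exp_half {α : ℝ} (hα : α ∈ Set.Ioo (0 : ℝ) 1) (L : ℝ) :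
    rexp ((1 + α) * L) ≤ 9 * rexp (rexp L / 2) := by
  have hR := Real.exp_pos L
  have h1 : rexp ((1 + α) * L) ≤ 1 + rexp L ^ 2 := by
    rcases le_total L 0 with h | h
    · have : rexp ((1 + α) * L) ≤ 1 := Real.exp_le_one_iff.2 (by nlinarith [hα.1])
      nlinarith
    · have : rexp ((1 + α) * L) ≤ rexp L ^ 2 := by
        rw [← Real.exp_nat_mul]
        apply Real.exp_le_exp.2
        push_cast
        nlinarith [hα.2]
      linarith
  have h2 := Real.quadratic_le_exp_of_nonneg (half_pos hR).le
  nlinarith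

/-- There exist constants `C, c > 0` depending only on `α` such that for all `s, t > 0`,
`|ν_{t,α}(s)| ≤ C t^{-α-1} exp(-c (s t^{-α})^{1/(1-α)})`. -/
theorem nuSub_bound
    (α : ℝ) (hα : α ∈ Set.Ioo (0 : ℝ) 1) :
    ∃ C : ℝ, 0 < C ∧ ∃ c : ℝ, 0 < c ∧ ∀ s t : ℝ, 0 < s → 0 < t →
      |nuSub α t s| ≤
        C * t ^ (-α - 1) * Real.exp (-c * (s * t ^ (-α)) ^ ((1:ℝ) / (1 - α))) := by
  have hpi := Real.pi_pos
  have h1α : 0 < 1 - α := by linarith [hα.2]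
  set θ : ℝ := π / 2 * (2 - α) with hθdef
  have hθ : θ ∈ Set.Ioo (π / 2) π :=
    ⟨by nlinarith, by nlinarith [mul_pos hpi hα.1]⟩
  have hαθ : α * θ < π / 2 := by
    have : 0 < π / 2 * (1 - α) ^ 2 := by positivity
    nlinarith
  have hθ0 : 0 < θ := by linarith [hθ.1]
  have hc : 0 < Real.cos (α * θ) :=
    Real.cos_pos_of_mem_Ioo ⟨by linarith [mul_pos hα.1 hθ0], hαθ⟩
  set c₀ : ℝ := Real.cos (α * θ) with hc₀
  set K : ℝ := ∫ u : ℝ, rexp (-(-Real.cos θ) * rexp u + (1 + α) * u)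
  have hK : 0 ≤ K := integral_nonneg fun u => (Real.exp_pos _).le
  refine ⟨1 / π * (9 * θ + K), by positivity, (c₀ / 2) ^ (1 / (1 - α)) / 2, by positivity,
    fun s t hs ht => ?_⟩
  have ht' : 0 < t ^ (-α - 1) := Real.rpow_pos_of_pos ht _
  set x : ℝ := s * t ^ (-α) with hxdef
  have hx : 0 < x := mul_pos hs (Real.rpow_pos_of_pos ht _)
  set L : ℝ := Real.log (c₀ / 2 * x) * (1 / (1 - α)) with hL
  have hR : rexp L = (c₀ / 2) ^ (1 / (1 - α)) * x ^ (1 / (1 - α)) := by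
    rw [← Real.mul_rpow (by positivity) hx.le, Real.rpow_def_of_pos (by positivity)]
  have hRL : c₀ * x * rexp (α * L) = 2 * rexp L := by
    have h1 : rexp ((1 - α) * L) = c₀ / 2 * x := by
      rw [hL, show (1 - α) * (Real.log (c₀ / 2 * x) * (1 / (1 - α))) = Real.log (c₀ / 2 * x) by
        field_simp, Real.exp_log (by positivity)]
    have h2 : rexp L = rexp ((1 - α) * L) * rexp (α * L) := by
      rw [← Real.exp_add]; ring_nf
    rw [h2, h1]; ring
  have hbound := abs_im_integral_wrightIntegrand_le hα hx hθ hαθ L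
  rw [← hc₀, hRL] at hbound
  have hsplit : rexp (rexp L + (1 + α) * L - 2 * rexp L) ≤ 9 * rexp (-(rexp L / 2)) := by
    have h1 := mul_le_mul_of_nonneg_right (exp_mul_le_nine_mul_exp_half hα L)
      (Real.exp_pos (-rexp L)).le
    rw [mul_assoc, ← Real.exp_add, ← Real.exp_add] at h1
    ring_nf at h1 ⊢
    exact h1
  have hsplit2 : rexp (-(2 * rexp L)) ≤ rexp (-(rexp L / 2)) :=
    Real.exp_le_exp.2 (by linarith [Real.exp_pos L])
  have hfin := hbound.trans (add_le_add (mul_le_mul_of_nonneg_left hsplit hθ0.le)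
    (mul_le_mul_of_nonneg_left hsplit2 hK))
  rw [nuSub, (hasSum_integral_wrightIntegrand hα hx hθ).tsum_eq, abs_mul, abs_mul,
    abs_of_pos ht', abs_of_pos (by positivity : 0 < 1 / π),
    show -((c₀ / 2) ^ (1 / (1 - α)) / 2) * x ^ (1 / (1 - α)) = -(rexp L / 2) by rw [hR]; ring]
  have := mul_le_mul_of_nonneg_left hfin (by positivity : 0 ≤ t ^ (-α - 1) * (1 / π))
  linarith
end
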